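/- For every p with 0 < p < 1 − p⃗_c, the H-model with parameter p does not percolate: θ_H(p) = 0. -/

import Mathlib

open MeasureTheory ENNReal

namespace RandomOrientation

/-- One step of the base-`(p, 1-p)` expansion map on `[0,1)`. -/
noncomputable def expand (p x : ℝ) : ℝ := if x < p then x / p else (x - p) / (1 - p)

/-- The `n`-th digit of the Bernoulli(`p`) expansion of `x`: for `x` uniformly
distributed on `[0,1)` the digits are i.i.d. `{true, false}`-valued with
`P(true) = p`. -/
noncomputable def bernDigit (p : ℝ) (n : ℕ) (x : ℝ) : Bool :=
  decide ((expand p)^[n] x < p)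

/-- The product over the countable index set `I` of Bernoulli(`p`) measures on
`Bool` (`P(true) = p`), realized as the joint distribution of the digits of the
Bernoulli(`p`) expansion of a uniform random point of `[0,1)`. -/
noncomputable def bernoulliProduct (I : Type*) [Encodable I] (p : ℝ) :
    Measure (I → Bool) :=
  Measure.map (fun x i => bernDigit p (Encodable.encode i) x)
    (volume.restrict (Set.Ico (0 : ℝ) 1))

/-- Edges of `ℤ²`: `(v, false)` is the horizontal edge from `v` to `v + (1,0)`,
`(v, true)` the vertical edge from `v` to `v + (0,1)`. -/
abbrev Edge : Type := (ℤ × ℤ) × Bool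

/-- An orientation configuration of the edges of `ℤ²`. -/
abbrev Config : Type := Edge → Bool

def eSrc (e : Edge) : ℤ × ℤ := e.1

def eDst (e : Edge) : ℤ × ℤ := if e.2 then (e.1.1, e.1.2 + 1) else (e.1.1 + 1, e.1.2)

/-- The law of the random orientation with parameter `p`: each edge independently
carries the bit `true` with probability `p`. -/
noncomputable def mu (p : ℝ) : Measure Config := bernoulliProduct Edge p

/-- The directed-edge relation of Grimmett's random-orientation model:
`ω e = true` means the edge `e` is oriented in the positive coordinate direction
(rightwards resp. upwards), `ω e = false` in the negative one. -/
def gStep (ω : Config) (u v : ℤ × ℤ) : Prop :=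
  ∃ e : Edge, (eSrc e = u ∧ eDst e = v ∧ ω e = true) ∨ (eSrc e = v ∧ eDst e = u ∧ ω e = false)

/-- Squared euclidean norm on `ℤ²`. -/
def normSq (v : ℤ × ℤ) : ℤ := v.1 ^ 2 + v.2 ^ 2

/-- The directed-edge relation of the H-model: `ω e = true` means the edge `e` is
oriented away from the origin, i.e. towards its endpoint of larger euclidean norm
(adjacent vertices of `ℤ²` never have equal norms). -/
def hStep (ω : Config) (u v : ℤ × ℤ) : Prop :=
  ∃ e : Edge, ((eSrc e = u ∧ eDst e = v) ∨ (eSrc e = v ∧ eDst e = u)) ∧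
    ω e = decide (normSq u < normSq v)

/-- There is an infinite directed self-avoiding path starting at the origin,
all of whose vertices lie in `S`, for the directed-step relation `R`. -/
def percolates (R : ℤ × ℤ → ℤ × ℤ → Prop) (S : Set (ℤ × ℤ)) : Prop :=
  ∃ γ : ℕ → ℤ × ℤ, γ 0 = (0, 0) ∧ Function.Injective γ ∧
    (∀ n, R (γ n) (γ (n + 1))) ∧ ∀ n, γ n ∈ S

/-- The (closed) North-East quadrant of `ℤ²`. -/
def NEquad : Set (ℤ × ℤ) := {v | 0 ≤ v.1 ∧ 0 ≤ v.2}

/-- `θ_H(p)`: percolation probability of the H-model with parameter `p`. -/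
noncomputable def thetaH (p : ℝ) : ℝ≥0∞ := mu p {ω | percolates (hStep ω) Set.univ}

/-- `θ_NE(p)`: probability of an infinite directed self-avoiding path from the
origin staying in the North-East quadrant, in the random-orientation model. -/
noncomputable def thetaNE (p : ℝ) : ℝ≥0∞ := mu p {ω | percolates (gStep ω) NEquad}

/-- `θ_G(p)`: percolation probability of Grimmett's random-orientation model. -/
noncomputable def thetaG (p : ℝ) : ℝ≥0∞ := mu p {ω | percolates (gStep ω) Set.univ}

/-- One step of oriented (north-east) bond percolation: from `u` one may move
rightwards or upwards along an open (`true`) edge. -/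
def neStep (ω : Config) (u v : ℤ × ℤ) : Prop :=
  (v = (u.1 + 1, u.2) ∧ ω ((u, false) : Edge) = true) ∨
  (v = (u.1, u.2 + 1) ∧ ω ((u, true) : Edge) = true)

/-- Probability of an infinite open oriented (self-avoiding) path from the origin
in oriented bond percolation with parameter `p`. -/
noncomputable def thetaVec (p : ℝ) : ℝ≥0∞ := mu p {ω | percolates (neStep ω) Set.univ}

/-- The critical probability `p⃗_c` of oriented bond percolation on `ℤ²`. -/
noncomputable def vecPc : ℝ := sInf {p : ℝ | 0 < thetaVec p}


section Generic

variable {ι : Type*}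

/-- The event `A` is determined by the coordinates in `F`. -/
def IsLocal (F : Finset ι) (A : Set (ι → Bool)) : Prop :=
  ∀ ω ω' : ι → Bool, (∀ e ∈ F, ω e = ω' e) → ω ∈ A → ω' ∈ A

lemma IsLocal.mono {F G : Finset ι} {A : Set (ι → Bool)} (h : IsLocal F A) (hFG : F ⊆ G) :
    IsLocal G A :=
  fun ω ω' hω => h ω ω' fun e he => hω e (hFG he)

lemma IsLocal.inter [DecidableEq ι] {F G : Finset ι} {A B : Set (ι → Bool)}
    (hA : IsLocal F A) (hB : IsLocal G B) : IsLocal (F ∪ G) (A ∩ B) :=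
  fun ω ω' hω h => ⟨hA.mono Finset.subset_union_left ω ω' hω h.1,
    hB.mono Finset.subset_union_right ω ω' hω h.2⟩

lemma IsLocal.compl {F : Finset ι} {A : Set (ι → Bool)} (hA : IsLocal F A) : IsLocal F Aᶜ :=
  fun ω ω' hω h h' => h (hA ω' ω (fun e he => (hω e he).symm) h')

lemma IsLocal.eq_preimage {F : Finset ι} {A : Set (ι → Bool)} (hA : IsLocal F A) :
    A = F.restrict ⁻¹' (F.restrict '' A) := by
  refine Set.Subset.antisymm (Set.subset_preimage_image _ _) ?_
  rintro ω ⟨ω', hω', h⟩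
  exact hA ω' ω (fun e he => congrFun h ⟨e, he⟩) hω'

lemma IsLocal.measurableSet {F : Finset ι} {A : Set (ι → Bool)} (hA : IsLocal F A) :
    MeasurableSet A := by
  rw [hA.eq_preimage]
  exact (Finset.measurable_restrict F) (Set.toFinite _).measurableSet

/-- The Bernoulli(`q`) law on `Bool`, as the law of the indicator that a uniform
variable is below `q`. -/
noncomputable def bern (q : ℝ) : Measure Bool :=
  (volume.restrict (Set.Ico (0 : ℝ) 1)).map (fun x => decide (x < q))

lemma measurable_decide_lt (q : ℝ) : Measurable (fun x : ℝ => decide (x < q)) :=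
  measurable_to_bool (by
    have : (fun x : ℝ => decide (x < q)) ⁻¹' {true} = Set.Iio q := by ext; simp
    rw [this]; exact measurableSet_Iio)

instance : IsProbabilityMeasure (volume.restrict (Set.Ico (0 : ℝ) 1)) := ⟨by simp⟩

instance (q : ℝ) : IsProbabilityMeasure (bern q) :=
  Measure.isProbabilityMeasure_map (measurable_decide_lt q).aemeasurable

lemma bern_true {q : ℝ} (h1 : q ≤ 1) : bern q {true} = ENNReal.ofReal q := by
  rw [bern, Measure.map_apply (measurable_decide_lt q) (by measurability),
    Measure.restrict_apply' measurableSet_Ico]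
  have : (fun x : ℝ => decide (x < q)) ⁻¹' {true} ∩ Set.Ico 0 1 = Set.Ico 0 q := by
    ext x; simp only [Set.mem_inter_iff, Set.mem_preimage, Set.mem_singleton_iff,
      decide_eq_true_eq, Set.mem_Ico]
    constructor
    · rintro ⟨a, b, c⟩; exact ⟨b, a⟩
    · rintro ⟨a, b⟩; exact ⟨b, a, by linarith⟩
  rw [this]; simp

lemma bern_false {q : ℝ} (h0 : 0 ≤ q) : bern q {false} = ENNReal.ofReal (1 - q) := by
  rw [bern, Measure.map_apply (measurable_decide_lt q) (by measurability),
    Measure.restrict_apply' measurableSet_Ico]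
  have : (fun x : ℝ => decide (x < q)) ⁻¹' {false} ∩ Set.Ico 0 1 = Set.Ico q 1 := by
    ext x; simp only [Set.mem_inter_iff, Set.mem_preimage, Set.mem_singleton_iff,
      decide_eq_false_iff_not, Set.mem_Ico, not_lt]
    constructor
    · rintro ⟨a, b, c⟩; exact ⟨a, c⟩
    · rintro ⟨a, b⟩; exact ⟨a, by linarith, b⟩
  rw [this]; simp

/-- The product Bernoulli(`q`) measure. -/
noncomputable def bernPi (ι : Type*) (q : ℝ) : Measure (ι → Bool) :=
  Measure.infinitePi (fun _ => bern q)

instance (q : ℝ) : IsProbabilityMeasure (bernPi ι q) := by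
  unfold bernPi; infer_instance

lemma bernPi_mono {q q' : ℝ} (h : q ≤ q') {A : Set (ι → Bool)} (hA : IsUpperSet A)
    (hm : MeasurableSet A) : bernPi ι q A ≤ bernPi ι q' A := by
  have key : ∀ r : ℝ, bernPi ι r = (Measure.infinitePi
      (fun _ : ι => volume.restrict (Set.Ico (0 : ℝ) 1))).map (fun x i => decide (x i < r)) :=
    fun r => (Measure.infinitePi_map_pi (μ := fun _ : ι => volume.restrict (Set.Ico (0 : ℝ) 1))
      (f := fun _ x => decide (x < r)) (fun _ => measurable_decide_lt r)).symm
  have hmeas : ∀ r : ℝ, Measurable (fun (x : ι → ℝ) i => decide (x i < r)) := fun r =>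
    measurable_pi_lambda _ fun i => (measurable_decide_lt r).comp (measurable_pi_apply i)
  rw [key, key, Measure.map_apply (hmeas q) hm, Measure.map_apply (hmeas q') hm]
  refine measure_mono fun x hx => hA (fun i => ?_) hx
  simp only [Bool.le_iff_imp, decide_eq_true_eq]
  intro hi; linarith

lemma bernPi_reindex (q : ℝ) {κ : Type*} {f : κ → ι} (hf : Function.Injective f) :
    (bernPi ι q).map (fun ω i => ω (f i)) = bernPi κ q :=
  Measure.map_infinitePi_infinitePi_of_inj hf

lemma measurable_reindex {κ : Type*} (f : κ → ι) :
    Measurable (fun (ω : ι → Bool) i => ω (f i)) := by fun_prop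

lemma bernPi_preimage_reindex (q : ℝ) {κ : Type*} {f : κ → ι} (hf : Function.Injective f)
    {A : Set (κ → Bool)} (hm : MeasurableSet A) :
    bernPi ι q ((fun ω i => ω (f i)) ⁻¹' A) = bernPi κ q A := by
  rw [← bernPi_reindex q hf, Measure.map_apply (measurable_reindex f) hm]

lemma bern_ext {μ ν : Measure Bool} (ht : μ {true} = ν {true}) (hf : μ {false} = ν {false}) :
    μ = ν := by
  refine Measure.ext_of_singleton fun b => ?_
  cases b <;> assumption

lemma bern_map_not {q : ℝ} (h0 : 0 ≤ q) (h1 : q ≤ 1) :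
    (bern q).map (fun b => !b) = bern (1 - q) := by
  have hm : Measurable (fun b : Bool => !b) := .of_discrete
  refine bern_ext ?_ ?_
  · rw [Measure.map_apply hm (by measurability), bern_true (by linarith), ← bern_false h0]
    congr 1; ext b; simp
  · rw [Measure.map_apply hm (by measurability), bern_false (by linarith), _root_.sub_sub_cancel,
      ← bern_true h1]
    congr 1; ext b; simp

lemma bernPi_map_not {q : ℝ} (h0 : 0 ≤ q) (h1 : q ≤ 1) :
    (bernPi ι q).map (fun ω i => !ω i) = bernPi ι (1 - q) := by
  rw [bernPi, bernPi, ← bern_map_not h0 h1]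
  exact Measure.infinitePi_map_pi (μ := fun _ : ι => bern q) (f := fun _ b => !b)
    (fun _ => .of_discrete)

lemma bernPi_inter_of_disjoint (q : ℝ) {F G : Finset ι} (hFG : Disjoint F G)
    {A B : Set (ι → Bool)} (hA : IsLocal F A) (hB : IsLocal G B) :
    bernPi ι q (A ∩ B) = bernPi ι q A * bernPi ι q B := by
  have h1 : ProbabilityTheory.iIndepFun (fun (i : ι) (ω : ι → Bool) => ω i) (bernPi ι q) :=
    ProbabilityTheory.iIndepFun_infinitePi (P := fun _ : ι => bern q) (X := fun _ b => b)
      (fun _ => measurable_id)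
  have h2 := h1.indepFun_finset F G hFG (fun i => measurable_pi_apply i)
  rw [hA.eq_preimage, hB.eq_preimage]
  exact h2.measure_inter_preimage_eq_mul _ _ (Set.toFinite _).measurableSet
    (Set.toFinite _).measurableSet

/-- Independent local events of probability bounded below cannot all fail. -/
lemma bernPi_iInter_compl_lt [DecidableEq ι] (q : ℝ) {F : ℕ → Finset ι} {A : ℕ → Set (ι → Bool)}
    (hF : ∀ i j, i < j → Disjoint (F i) (F j)) (hA : ∀ i, IsLocal (F i) (A i)) {δ : ℝ≥0∞}
    (hδ : 0 < δ) (hAδ : ∀ i, δ ≤ bernPi ι q (A i)) {ε : ℝ≥0∞} (hε : 0 < ε) :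
    ∃ N, bernPi ι q (⋂ i ∈ Finset.range N, (A i)ᶜ) < ε := by
  have key : ∀ N, IsLocal ((Finset.range N).biUnion F) (⋂ i ∈ Finset.range N, (A i)ᶜ) ∧
      bernPi ι q (⋂ i ∈ Finset.range N, (A i)ᶜ) ≤ (1 - δ) ^ N := by
    intro N
    induction N with
    | zero => exact ⟨fun _ _ _ _ => by simp, by simp⟩
    | succ N ih =>
      have hset : (⋂ i ∈ Finset.range (N + 1), (A i)ᶜ) =
          (⋂ i ∈ Finset.range N, (A i)ᶜ) ∩ (A N)ᶜ := by
        ext ω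
        simp only [Set.mem_iInter, Set.mem_inter_iff, Finset.mem_range, Nat.lt_succ_iff_lt_or_eq]
        constructor
        · intro h; exact ⟨fun i hi => h i (.inl hi), h N (.inr rfl)⟩
        · rintro ⟨h, h'⟩ i (hi | rfl)
          exacts [h i hi, h']
      rw [hset]
      constructor
      · refine (ih.1.inter (hA N).compl).mono ?_
        rw [Finset.range_add_one, Finset.biUnion_insert, Finset.union_comm]
      · rw [bernPi_inter_of_disjoint q ?_ ih.1 (hA N).compl, pow_succ]
        · refine mul_le_mul' ih.2 ?_
          rw [prob_compl_eq_one_sub (hA N).measurableSet]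
          exact tsub_le_tsub_left (hAδ N) _
        · rw [Finset.disjoint_biUnion_left]
          intro i hi
          exact hF i N (Finset.mem_range.1 hi)
  have hlt : 1 - δ < 1 := ENNReal.sub_lt_self (by simp) (by simp) hδ.ne'
  have htend := ENNReal.tendsto_pow_atTop_nhds_zero_of_lt_one hlt
  obtain ⟨N, hN⟩ := (htend.eventually (gt_mem_nhds hε)).exists
  exact ⟨N, (key N).2.trans_lt hN⟩

lemma measureReal_eq_sum {α : Type*} [Fintype α] [MeasurableSpace α] [MeasurableSingletonClass α]
    (ν : Measure α) [IsFiniteMeasure ν] (A : Set α) :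
    ν.real A = ∑ a, ν.real {a} * A.indicator (fun _ => (1 : ℝ)) a := by
  classical
  have h : ν.real A = ∑ a ∈ Finset.univ.filter (· ∈ A), ν.real {a} := by
    rw [sum_measureReal_singleton]; congr 1; ext; simp
  rw [h, Finset.sum_filter]
  exact Finset.sum_congr rfl fun a _ => by by_cases ha : a ∈ A <;> simp [ha]

/-- Harris' inequality for increasing local events. -/
lemma bernPi_harris [DecidableEq ι] (q : ℝ) {F G : Finset ι} {A B : Set (ι → Bool)}
    (hA : IsLocal F A) (hB : IsLocal G B) (uA : IsUpperSet A) (uB : IsUpperSet B) :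
    bernPi ι q A * bernPi ι q B ≤ bernPi ι q (A ∩ B) := by
  classical
  set H := F ∪ G
  have hA' := hA.mono (Finset.subset_union_left : F ⊆ H)
  have hB' := hB.mono (Finset.subset_union_right : G ⊆ H)
  have hAB : IsLocal H (A ∩ B) := hA.inter hB
  set ν : Measure (H → Bool) := Measure.pi fun _ => bern q
  have hreal : ∀ {C : Set (ι → Bool)}, IsLocal H C →
      bernPi ι q C = ν (H.restrict '' C) := by
    intro C hC
    conv_lhs => rw [hC.eq_preimage]
    rw [← Measure.map_apply (Finset.measurable_restrict H) (Set.toFinite _).measurableSet, bernPi,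
      Measure.infinitePi_map_restrict]
  have hup : ∀ {C : Set (ι → Bool)}, IsLocal H C → IsUpperSet C →
      Monotone ((H.restrict '' C).indicator (fun _ => (1 : ℝ))) := by
    intro C hC uC a b hab
    by_cases ha : a ∈ H.restrict '' C
    · have hb : b ∈ H.restrict '' C := by
        obtain ⟨ω, hω, rfl⟩ := ha
        refine ⟨fun i => if h : i ∈ H then b ⟨i, h⟩ || ω i else ω i, uC ?_ hω, ?_⟩
        · intro i
          by_cases h : i ∈ H
          · simp only [h, dif_pos]; exact le_sup_right
          · simp [h]
        · ext ⟨i, hi⟩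
          have := hab ⟨i, hi⟩
          simp only [Finset.restrict, hi, dif_pos] at this ⊢
          exact sup_eq_left.2 this
      simp [ha, hb]
    · rw [Set.indicator_of_notMem ha]
      exact Set.indicator_nonneg (fun _ _ => zero_le_one) _
  have hfkg := fkg (μ := fun a => ν.real {a})
    (f := (H.restrict '' A).indicator (fun _ => (1 : ℝ)))
    (g := (H.restrict '' B).indicator (fun _ => (1 : ℝ)))
    (fun _ => measureReal_nonneg) (fun _ => Set.indicator_nonneg (fun _ _ => zero_le_one) _)
    (fun _ => Set.indicator_nonneg (fun _ _ => zero_le_one) _) (hup hA' uA) (hup hB' uB) ?_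
  · have hsum : ∑ a, ν.real {a} = 1 := by
      simp
    have hmul : ∀ a, (H.restrict '' A).indicator (fun _ => (1 : ℝ)) a *
        (H.restrict '' B).indicator (fun _ => (1 : ℝ)) a =
        (H.restrict '' (A ∩ B)).indicator (fun _ => (1 : ℝ)) a := by
      intro a
      have himg : H.restrict '' (A ∩ B) = H.restrict '' A ∩ H.restrict '' B := by
        refine Set.Subset.antisymm (Set.image_inter_subset _ _ _) ?_
        rintro _ ⟨⟨ω, hω, rfl⟩, ω', hω', h⟩
        exact ⟨ω, ⟨hω, hB' ω' ω (fun e he => congrFun h ⟨e, he⟩) hω'⟩, rfl⟩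
      rw [himg, ← Set.inter_indicator_mul]
      simp
    simp only [hmul] at hfkg
    rw [hsum, one_mul, ← measureReal_eq_sum, ← measureReal_eq_sum, ← measureReal_eq_sum] at hfkg
    rw [hreal hA', hreal hB', hreal hAB, ← ENNReal.toReal_le_toReal
      (ENNReal.mul_ne_top (measure_ne_top _ _) (measure_ne_top _ _)) (measure_ne_top _ _),
      ENNReal.toReal_mul]
    exact hfkg
  · intro a b
    simp only [ν, Measure.real, Measure.pi_singleton, ENNReal.toReal_prod,
      ← Finset.prod_mul_distrib]
    refine le_of_eq (Finset.prod_congr rfl fun i _ => ?_)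
    simp only [Pi.inf_apply, Pi.sup_apply]
    cases a i <;> cases b i <;> simp [mul_comm]

lemma bernPi_forall_false (q : ℝ) (h0 : 0 ≤ q) (F : Finset ι) :
    bernPi ι q {ω | ∀ e ∈ F, ω e = false} = ENNReal.ofReal (1 - q) ^ F.card := by
  have : {ω : ι → Bool | ∀ e ∈ F, ω e = false} = Set.pi F (fun _ => {false}) := by
    ext; simp
  rw [this, bernPi, Measure.infinitePi_pi _ (fun _ _ => by measurability)]
  simp [bern_false h0]

lemma bernPi_true (q : ℝ) (h1 : q ≤ 1) (e : ι) :
    bernPi ι q {ω | ω e = true} = ENNReal.ofReal q := by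
  have : {ω : ι → Bool | ω e = true} = Set.pi ({e} : Finset ι) (fun _ => {true}) := by
    ext; simp
  rw [this, bernPi, Measure.infinitePi_pi _ (fun _ _ => by measurability)]
  simp [bern_true h1]

end Generic

section Digits

lemma measurable_expand (p : ℝ) : Measurable (expand p) := by
  unfold expand
  exact Measurable.ite measurableSet_Iio (by fun_prop) (by fun_prop)

lemma measurable_bernDigit (p : ℝ) (n : ℕ) : Measurable (bernDigit p n) :=
  (measurable_decide_lt p).comp ((measurable_expand p).iterate n)

lemma bernDigit_succ (p : ℝ) (n : ℕ) (x : ℝ) :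
    bernDigit p (n + 1) x = bernDigit p n (expand p x) := rfl

lemma measurable_digits (I : Type*) [Encodable I] (p : ℝ) :
    Measurable (fun (x : ℝ) (i : I) => bernDigit p (Encodable.encode i) x) :=
  measurable_pi_lambda _ fun _ => measurable_bernDigit p _

lemma volume_expand_lower {p : ℝ} (hp : 0 < p) (hp1 : p < 1) (B : Set ℝ) :
    volume.restrict (Set.Ico (0 : ℝ) 1) ({x | x < p} ∩ expand p ⁻¹' B) =
      ENNReal.ofReal p * volume.restrict (Set.Ico (0 : ℝ) 1) B := by
  rw [Measure.restrict_apply' measurableSet_Ico, Measure.restrict_apply' measurableSet_Ico]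
  have : {x | x < p} ∩ expand p ⁻¹' B ∩ Set.Ico 0 1 =
      (fun x => p⁻¹ * x) ⁻¹' (B ∩ Set.Ico 0 1) := by
    ext x
    simp only [Set.mem_inter_iff, Set.mem_ofPred_eq, Set.mem_preimage, Set.mem_Ico]
    rw [inv_mul_eq_div, div_lt_one hp]
    constructor
    · rintro ⟨⟨hx, hB⟩, h0, -⟩
      rw [expand, if_pos hx] at hB
      exact ⟨hB, by positivity, hx⟩
    · rintro ⟨hB, h0, hx⟩
      refine ⟨⟨hx, ?_⟩, ?_, by linarith⟩
      · rwa [expand, if_pos hx]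
      · rcases div_nonneg_iff.1 h0 with h | h <;> linarith [h.1, h.2]
  rw [this, Real.volume_preimage_mul_left (inv_ne_zero hp.ne'), inv_inv, abs_of_pos hp]

lemma volume_expand_upper {p : ℝ} (hp : 0 < p) (hp1 : p < 1) (B : Set ℝ) :
    volume.restrict (Set.Ico (0 : ℝ) 1) ({x | ¬ x < p} ∩ expand p ⁻¹' B) =
      ENNReal.ofReal (1 - p) * volume.restrict (Set.Ico (0 : ℝ) 1) B := by
  rw [Measure.restrict_apply' measurableSet_Ico, Measure.restrict_apply' measurableSet_Ico]
  have hq : 0 < 1 - p := by linarith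
  have : {x | ¬ x < p} ∩ expand p ⁻¹' B ∩ Set.Ico 0 1 =
      (fun x => x + -p) ⁻¹' ((fun x => (1 - p)⁻¹ * x) ⁻¹' (B ∩ Set.Ico 0 1)) := by
    ext x
    simp only [Set.mem_inter_iff, Set.mem_ofPred_eq, Set.mem_preimage, Set.mem_Ico]
    rw [← sub_eq_add_neg, inv_mul_eq_div, div_lt_one hq]
    constructor
    · rintro ⟨⟨hx, hB⟩, h0, h1⟩
      rw [expand, if_neg hx] at hB
      exact ⟨hB, div_nonneg (by linarith) hq.le, by linarith⟩
    · rintro ⟨hB, h0, h1⟩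
      have hx : ¬ x < p := by
        rcases div_nonneg_iff.1 h0 with h | h <;> linarith [h.1, h.2]
      refine ⟨⟨hx, ?_⟩, by linarith, by linarith⟩
      rwa [expand, if_neg hx]
  rw [this, measure_preimage_add_right, Real.volume_preimage_mul_left (inv_ne_zero hq.ne'),
    inv_inv, abs_of_pos hq]

lemma volume_digit_zero_inter {p : ℝ} (hp : 0 < p) (hp1 : p < 1) (T : Set Bool) (B : Set ℝ) :
    volume.restrict (Set.Ico (0 : ℝ) 1) ({x | decide (x < p) ∈ T} ∩ expand p ⁻¹' B) =
      bern p T * volume.restrict (Set.Ico (0 : ℝ) 1) B := by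
  classical
  have hT : bern p T = (if true ∈ T then ENNReal.ofReal p else 0) +
      (if false ∈ T then ENNReal.ofReal (1 - p) else 0) := by
    rw [← bern_true hp1.le, ← bern_false hp.le,
      ← measure_inter_add_sdiff T (MeasurableSet.of_discrete (s := {true}))]
    congr 1
    · split_ifs with h
      · congr 1; ext b; cases b <;> simp [h]
      · convert measure_empty (μ := bern p)
        ext b; cases b <;> simp [h]
    · split_ifs with h
      · congr 1; ext b; cases b <;> simp [h]
      · convert measure_empty (μ := bern p)
        ext b; cases b <;> simp [h]
  set U := volume.restrict (Set.Ico (0 : ℝ) 1)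
  rw [← measure_inter_add_sdiff _ (measurableSet_Iio (a := p)), hT, add_mul]
  congr 1
  · split_ifs with h
    · rw [← volume_expand_lower hp hp1]
      congr 1; ext x
      simp only [Set.mem_inter_iff, Set.mem_ofPred_eq, Set.mem_Iio, Set.mem_preimage]
      constructor
      · rintro ⟨⟨_, b⟩, c⟩; exact ⟨c, b⟩
      · rintro ⟨c, b⟩; exact ⟨⟨by simpa [c] using h, b⟩, c⟩
    · rw [zero_mul]
      convert measure_empty (μ := U)
      ext x
      simp only [Set.mem_inter_iff, Set.mem_ofPred_eq, Set.mem_Iio, Set.mem_empty_iff_false,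
        iff_false]
      rintro ⟨⟨a, _⟩, c⟩
      exact h (by simpa [c] using a)
  · split_ifs with h
    · rw [← volume_expand_upper hp hp1]
      congr 1; ext x
      simp only [Set.mem_inter_iff, Set.mem_sdiff, Set.mem_ofPred_eq, Set.mem_Iio, Set.mem_preimage]
      constructor
      · rintro ⟨⟨_, b⟩, c⟩; exact ⟨c, b⟩
      · rintro ⟨c, b⟩; exact ⟨⟨by simpa [c] using h, b⟩, c⟩
    · rw [zero_mul]
      convert measure_empty (μ := U)
      ext x
      simp only [Set.mem_inter_iff, Set.mem_sdiff, Set.mem_ofPred_eq, Set.mem_Iio,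
        Set.mem_empty_iff_false, iff_false]
      rintro ⟨⟨a, _⟩, c⟩
      exact h (by simpa [c] using a)

lemma volume_forall_digits {p : ℝ} (hp : 0 < p) (hp1 : p < 1) (N : ℕ) (t : ℕ → Set Bool) :
    volume.restrict (Set.Ico (0 : ℝ) 1) {x | ∀ i < N, bernDigit p i x ∈ t i} =
      ∏ i ∈ Finset.range N, bern p (t i) := by
  induction N generalizing t with
  | zero => simp
  | succ N ih =>
    have hset : {x | ∀ i < N + 1, bernDigit p i x ∈ t i} = {x | decide (x < p) ∈ t 0} ∩
        expand p ⁻¹' {x | ∀ i < N, bernDigit p i x ∈ t (i + 1)} := by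
      ext x
      simp only [Set.mem_ofPred_eq, Set.mem_inter_iff, Set.mem_preimage, ← bernDigit_succ]
      constructor
      · intro h; exact ⟨h 0 (Nat.succ_pos _), fun i hi => h (i + 1) (by omega)⟩
      · rintro ⟨h0, h⟩ (_ | i) hi
        exacts [h0, h i (by omega)]
    rw [hset, volume_digit_zero_inter hp hp1, ih, Finset.prod_range_succ', mul_comm]

lemma bernoulliProduct_eq_bernPi (I : Type*) [Encodable I] {p : ℝ} (hp : 0 < p) (hp1 : p < 1) :
    bernoulliProduct I p = bernPi I p := by
  classical
  refine Measure.eq_infinitePi _ fun s t _ => ?_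
  rw [bernoulliProduct, Measure.map_apply (measurable_digits I p)
    (MeasurableSet.pi s.countable_toSet fun _ _ => .of_discrete)]
  set N := s.sup Encodable.encode + 1
  let t' : ℕ → Set Bool := fun n => {b | ∀ i ∈ s, Encodable.encode i = n → b ∈ t i}
  have hN : ∀ i ∈ s, Encodable.encode i < N := fun i hi =>
    Nat.lt_succ_of_le (Finset.le_sup (f := Encodable.encode) hi)
  have hset : (fun (x : ℝ) (i : I) => bernDigit p (Encodable.encode i) x) ⁻¹' (Set.pi s t) =
      {x | ∀ n < N, bernDigit p n x ∈ t' n} := by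
    ext x
    simp only [Set.mem_preimage, Set.mem_pi, Finset.mem_coe, Set.mem_ofPred_eq, t']
    constructor
    · rintro h n _ i hi rfl; exact h i hi
    · intro h i hi; exact h _ (hN i hi) i hi rfl
  have ht' : ∀ i ∈ s, t' (Encodable.encode i) = t i := by
    intro i hi
    ext b
    simp only [t', Set.mem_ofPred_eq]
    constructor
    · intro h; exact h i hi rfl
    · intro h j _ hij; rwa [Encodable.encode_injective hij]
  rw [hset, volume_forall_digits hp hp1, ← Finset.prod_subset (s₁ := s.image Encodable.encode)]
  · rw [Finset.prod_image fun _ _ _ _ h => Encodable.encode_injective h]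
    exact Finset.prod_congr rfl fun i hi => by rw [ht' i hi]
  · intro n hn
    obtain ⟨i, hi, rfl⟩ := Finset.mem_image.1 hn
    exact Finset.mem_range.2 (hN i hi)
  · intro n _ hn
    have : t' n = Set.univ := by
      refine Set.eq_univ_of_forall fun b i hi h => (hn ?_).elim
      exact Finset.mem_image.2 ⟨i, hi, h⟩
    rw [this, measure_univ]

lemma bernDigit_of_nonpos {p : ℝ} (hp : p ≤ 0) (n : ℕ) {x : ℝ} (hx : 0 ≤ x) :
    bernDigit p n x = false := by
  induction n generalizing x with
  | zero => exact decide_eq_false (not_lt.2 (hp.trans hx))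
  | succ n ih =>
    rw [bernDigit_succ]
    apply ih
    rw [expand, if_neg (by linarith)]
    exact div_nonneg (by linarith) (by linarith)

lemma bernDigit_one (n : ℕ) {x : ℝ} (hx : x < 1) : bernDigit 1 n x = true := by
  induction n generalizing x with
  | zero => exact decide_eq_true hx
  | succ n ih =>
    rw [bernDigit_succ]
    apply ih
    rwa [expand, if_pos hx, div_one]

lemma thetaVec_of_nonpos {p : ℝ} (hp : p ≤ 0) : thetaVec p = 0 := by
  have hsub : {ω | percolates (neStep ω) Set.univ} ⊆ {ω : Config | ω ≠ fun _ => false} := by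
    rintro ω ⟨γ, -, -, h, -⟩ rfl
    rcases h 0 with h | h <;> simp at h
  refine measure_mono_null hsub ?_
  have hm : MeasurableSet {ω : Config | ω ≠ fun _ => false} :=
    (measurableSet_singleton (fun _ => false : Config)).compl
  rw [mu, bernoulliProduct, Measure.map_apply (measurable_digits Edge p) hm,
    Measure.restrict_apply' measurableSet_Ico]
  convert measure_empty (μ := (volume : Measure ℝ))
  ext x
  simp only [Set.mem_inter_iff, Set.mem_preimage, Set.mem_ofPred_eq, Set.mem_empty_iff_false,
    iff_false, not_and]
  intro h hx
  exact h (funext fun e => bernDigit_of_nonpos hp _ hx.1)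

lemma thetaVec_one_pos : 0 < thetaVec 1 := by
  have hsub : (fun (x : ℝ) (e : Edge) => bernDigit 1 (Encodable.encode e) x) ⁻¹'
      {ω | percolates (neStep ω) Set.univ} ⊇ Set.Ico 0 1 := by
    intro x hx
    refine ⟨fun n => (n, 0), rfl, fun a b h => by simpa using h, fun n => .inl ⟨by simp, ?_⟩,
      fun _ => trivial⟩
    exact bernDigit_one _ hx.2
  refine lt_of_lt_of_le ?_ (Measure.le_map_apply (measurable_digits Edge 1).aemeasurable _)
  refine lt_of_lt_of_le ?_ (measure_mono hsub)
  simp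

end Digits

section Shapes

/-- The vertical edge above `(x, y)`. -/
def vEdge (x y : ℕ) : Edge := (((x : ℤ), (y : ℤ)), true)

/-- The horizontal edge to the right of `(x, y)`. -/
def hEdge (x y : ℕ) : Edge := (((x : ℤ), (y : ℤ)), false)

/-- A lower set in the quadrant which contains the square of side `k` and lies in the square of
side `n`. -/
structure IsShape (n k : ℕ) (S : Set (ℕ × ℕ)) : Prop where
  lower : IsLowerSet S
  le_left : ∀ x y, (x, y) ∈ S → x ≤ n
  le_right : ∀ x y, (x, y) ∈ S → y ≤ n
  diag_mem : (k, k) ∈ S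

/-- Every horizontal edge off the axis leaving `S` from a column before `b` is open. -/
def HClosed (b : ℕ) (η : Config) (S : Set (ℕ × ℕ)) : Prop :=
  ∀ x y, (x, y) ∈ S → x < b → 1 ≤ y → (x + 1, y) ∉ S → η (hEdge x y) = true

/-- Every vertical edge off the axis leaving `S` from a row below `b` is open. -/
def VClosed (b : ℕ) (η : Config) (S : Set (ℕ × ℕ)) : Prop :=
  ∀ x y, (x, y) ∈ S → y < b → 1 ≤ x → (x, y + 1) ∉ S → η (vEdge x y) = true

/-- Some shape satisfying `c` is closed. -/
def shapeEvent (n k : ℕ) (c : Set (ℕ × ℕ) → Prop) (b : ℕ) : Set Config :=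
  {η | ∃ S, IsShape n k S ∧ c S ∧ HClosed (n + 1) η S ∧ VClosed b η S}

/-- There is a closed shape of width `n`. -/
def closedEvent (n k : ℕ) : Set Config := shapeEvent n k (fun S => (n, 0) ∈ S) (n + 1)

/-- There is a shape of width and height `n` which is closed except possibly at its top. -/
def openTopEvent (n k : ℕ) : Set Config :=
  shapeEvent n k (fun S => (n, 0) ∈ S ∧ (0, n) ∈ S) n

/-- There is a closed shape of width and height `n`. -/
def squareEvent (n k : ℕ) : Set Config :=
  shapeEvent n k (fun S => (n, 0) ∈ S ∧ (0, n) ∈ S) (n + 1)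

lemma isUpperSet_shapeEvent (n k : ℕ) (c : Set (ℕ × ℕ) → Prop) (b : ℕ) :
    IsUpperSet (shapeEvent n k c b) := by
  have h : ∀ {η η' : Config}, η ≤ η' → ∀ e, η e = true → η' e = true :=
    fun hle e he => Bool.le_iff_imp.1 (hle e) he
  rintro η η' hle ⟨S, hS, hc, hh, hv⟩
  exact ⟨S, hS, hc, fun x y h1 h2 h3 h4 => h hle _ (hh x y h1 h2 h3 h4),
    fun x y h1 h2 h3 h4 => h hle _ (hv x y h1 h2 h3 h4)⟩

/-- The square `[-m, m]²`. -/
def inBox (m : ℕ) (v : ℤ × ℤ) : Prop := |v.1| ≤ m ∧ |v.2| ≤ m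

open Classical in
/-- The edges of the square of radius `n + 1` which are not edges of the square of radius `k`. -/
noncomputable def annulus (n k : ℕ) : Finset Edge :=
  ((Finset.Icc (-(n + 1 : ℤ)) (n + 1) ×ˢ Finset.Icc (-(n + 1 : ℤ)) (n + 1)) ×ˢ Finset.univ).filter
    fun e => inBox (n + 1) (eDst e) ∧ ¬ (inBox k (eSrc e) ∧ inBox k (eDst e))

lemma mem_annulus {n k : ℕ} {e : Edge} : e ∈ annulus n k ↔
    inBox (n + 1) (eSrc e) ∧ inBox (n + 1) (eDst e) ∧ ¬ (inBox k (eSrc e) ∧ inBox k (eDst e)) := by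
  simp only [annulus, Finset.mem_filter]
  refine and_congr_left fun _ => ?_
  simp [inBox, eSrc, abs_le]

lemma annulus_disjoint {n k n' k' : ℕ} (h : n + 1 ≤ k') :
    Disjoint (annulus n k) (annulus n' k') := by
  have hle : ∀ v, inBox (n + 1) v → inBox k' v := fun v hv =>
    ⟨hv.1.trans (by exact_mod_cast h), hv.2.trans (by exact_mod_cast h)⟩
  rw [Finset.disjoint_left]
  intro e h1 h2
  rw [mem_annulus] at h1 h2
  exact h2.2.2 ⟨hle _ h1.1, hle _ h1.2.1⟩

lemma vEdge_mem_annulus {n k x y : ℕ} (hx : x ≤ n) (hy : y ≤ n) (h : k < x ∨ k < y + 1) :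
    vEdge x y ∈ annulus n k := by
  simp only [mem_annulus, inBox, vEdge, eSrc, eDst, if_true, abs_le]
  push_cast
  omega

lemma hEdge_mem_annulus {n k x y : ℕ} (hx : x ≤ n) (hy : y ≤ n) (h : k < x + 1 ∨ k < y) :
    hEdge x y ∈ annulus n k := by
  simp only [mem_annulus, inBox, hEdge, eSrc, eDst, Bool.false_eq_true, if_false, abs_le]
  push_cast
  omega

lemma isLocal_shapeEvent (n k : ℕ) (c : Set (ℕ × ℕ) → Prop) (b : ℕ) :
    IsLocal (annulus n k) (shapeEvent n k c b) := by
  rintro η η' heq ⟨S, hS, hc, hh, hv⟩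
  refine ⟨S, hS, hc, fun x y h1 h2 h3 h4 => ?_, fun x y h1 h2 h3 h4 => ?_⟩
  · rw [← heq _ (hEdge_mem_annulus (hS.le_left _ _ h1) (hS.le_right _ _ h1) ?_)]
    · exact hh x y h1 h2 h3 h4
    · by_contra! hlt
      exact h4 (hS.lower (Prod.mk_le_mk.2 ⟨hlt.1, hlt.2⟩) hS.diag_mem)
  · rw [← heq _ (vEdge_mem_annulus (hS.le_left _ _ h1) (hS.le_right _ _ h1) ?_)]
    · exact hv x y h1 h2 h3 h4
    · by_contra! hlt
      exact h4 (hS.lower (Prod.mk_le_mk.2 ⟨hlt.1, hlt.2⟩) hS.diag_mem)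

/-- The action of the reflection in the diagonal on edges. -/
def swapEdge (e : Edge) : Edge := ((e.1.2, e.1.1), !e.2)

lemma swapEdge_involutive : Function.Involutive swapEdge := fun e => by simp [swapEdge]

lemma swapEdge_mem_annulus {n k : ℕ} {e : Edge} (he : e ∈ annulus n k) :
    swapEdge e ∈ annulus n k := by
  obtain ⟨⟨x, y⟩, b⟩ := e
  cases b <;> simp only [mem_annulus, inBox, swapEdge, eSrc, eDst, abs_le] at he ⊢ <;>
    simp at he ⊢ <;> omega

lemma IsShape.swap {n k : ℕ} {S : Set (ℕ × ℕ)} (hS : IsShape n k S) :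
    IsShape n k (Prod.swap ⁻¹' S) where
  lower _ _ hab ha := hS.lower (Prod.swap_le_swap.2 hab) ha
  le_left _ _ h := hS.le_right _ _ h
  le_right _ _ h := hS.le_left _ _ h
  diag_mem := hS.diag_mem

lemma HClosed.swap {b : ℕ} {η : Config} {S : Set (ℕ × ℕ)}
    (h : HClosed b (fun e => η (swapEdge e)) S) : VClosed b η (Prod.swap ⁻¹' S) :=
  fun x y h1 h2 h3 h4 => h y x h1 h2 h3 h4

lemma VClosed.swap {b : ℕ} {η : Config} {S : Set (ℕ × ℕ)}
    (h : VClosed b (fun e => η (swapEdge e)) S) : HClosed b η (Prod.swap ⁻¹' S) :=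
  fun x y h1 h2 h3 h4 => h y x h1 h2 h3 h4

/-- The union of a closed shape of width `n` and one of height `n` is a closed square shape. -/
lemma squareEvent_of_closedEvent {n k : ℕ} {η : Config} (h : η ∈ closedEvent n k)
    (h' : (fun e => η (swapEdge e)) ∈ closedEvent n k) : η ∈ squareEvent n k := by
  obtain ⟨S, hS, hc, hh, hv⟩ := h
  obtain ⟨S', hS', hc', hh', hv'⟩ := h'
  refine ⟨S ∪ Prod.swap ⁻¹' S', ⟨hS.lower.union hS'.swap.lower, ?_, ?_, .inl hS.diag_mem⟩,
    ⟨.inl hc, .inr hc'⟩, ?_, ?_⟩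
  · rintro x y (h | h)
    exacts [hS.le_left _ _ h, hS'.swap.le_left _ _ h]
  · rintro x y (h | h)
    exacts [hS.le_right _ _ h, hS'.swap.le_right _ _ h]
  · rintro x y (h | h) h2 h3 h4
    exacts [hh x y h h2 h3 fun h5 => h4 (.inl h5), hv'.swap x y h h2 h3 fun h5 => h4 (.inr h5)]
  · rintro x y (h | h) h2 h3 h4
    exacts [hv x y h h2 h3 fun h5 => h4 (.inl h5), hh'.swap x y h h2 h3 fun h5 => h4 (.inr h5)]

/-- The intersection of a shape closed except at its top with one closed except at its right
side is a closed square shape. -/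
lemma squareEvent_of_openTopEvent {n k : ℕ} {η : Config} (h : η ∈ openTopEvent n k)
    (h' : (fun e => η (swapEdge e)) ∈ openTopEvent n k) : η ∈ squareEvent n k := by
  obtain ⟨S, hS, ⟨hc, hd⟩, hh, hv⟩ := h
  obtain ⟨S', hS', ⟨hc', hd'⟩, hh', hv'⟩ := h'
  refine ⟨S ∩ Prod.swap ⁻¹' S', ⟨hS.lower.inter hS'.swap.lower, fun x y h => hS.le_left x y h.1,
    fun x y h => hS.le_right x y h.1, ⟨hS.diag_mem, hS'.diag_mem⟩⟩,
    ⟨⟨hc, hd'⟩, ⟨hd, hc'⟩⟩, ?_, ?_⟩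
  · rintro x y ⟨h, h'⟩ h2 h3 h4
    by_cases h5 : (x + 1, y) ∈ S
    · have := hS.le_left _ _ h5
      exact hv'.swap x y h' (by omega) h3 fun h6 => h4 ⟨h5, h6⟩
    · exact hh x y h h2 h3 h5
  · rintro x y ⟨h, h'⟩ h2 h3 h4
    by_cases h5 : (x, y + 1) ∈ Prod.swap ⁻¹' S'
    · have := hS'.swap.le_right _ _ h5
      exact hv x y h (by omega) h3 fun h6 => h4 ⟨h6, h5⟩
    · exact hh'.swap x y h' h2 h3 h5

end Shapes

section Paths

/-- An infinite open oriented path started at the origin. -/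
structure IsNEPath (ω : Config) (γ : ℕ → ℤ × ℤ) : Prop where
  zero : γ 0 = (0, 0)
  step : ∀ n, neStep ω (γ n) (γ (n + 1))

variable {ω : Config} {γ : ℕ → ℤ × ℤ}

lemma IsNEPath.monotone (h : IsNEPath ω γ) : Monotone γ := by
  refine monotone_nat_of_le_succ fun n => ?_
  rcases h.step n with ⟨h, -⟩ | ⟨h, -⟩ <;> rw [h, Prod.le_def] <;> simp

lemma IsNEPath.sum_eq (h : IsNEPath ω γ) (n : ℕ) : (γ n).1 + (γ n).2 = n := by
  induction n with
  | zero => simp [h.zero]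
  | succ n ih =>
    rcases h.step n with ⟨h, -⟩ | ⟨h, -⟩ <;> rw [h] <;> push_cast <;> omega

/-- The path leaves `(-∞, a] × (-∞, b]` either to the right or to the top. -/
lemma IsNEPath.exit (h : IsNEPath ω γ) {a b : ℤ} (ha : 0 ≤ a) (hb : 0 ≤ b) :
    ∃ i, ((γ i).1 = a ∧ (γ i).2 ≤ b ∧ γ (i + 1) = (a + 1, (γ i).2) ∧
        ω (((a, (γ i).2), false) : Edge) = true) ∨
      ((γ i).2 = b ∧ (γ i).1 ≤ a ∧ γ (i + 1) = ((γ i).1, b + 1) ∧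
        ω ((((γ i).1, b), true) : Edge) = true) := by
  classical
  have hex : ∃ i, a < (γ i).1 ∨ b < (γ i).2 := by
    refine ⟨(a + b + 1).toNat, ?_⟩
    have := h.sum_eq (a + b + 1).toNat
    omega
  obtain ⟨i, hi⟩ : ∃ i, Nat.find hex = i + 1 := by
    refine Nat.exists_eq_succ_of_ne_zero fun h0 => ?_
    have := Nat.find_spec hex
    rw [h0, h.zero] at this
    simp only at this
    omega
  have h1 := Nat.find_spec hex
  have h2 := Nat.find_min hex (m := i) (by omega)
  rw [hi] at h1
  push Not at h2
  refine ⟨i, ?_⟩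
  rcases h.step i with ⟨hs, ho⟩ | ⟨hs, ho⟩
  · left
    rw [hs] at h1
    have : (γ i).1 = a := by simp only at h1; omega
    refine ⟨this, h2.2, by rw [hs, this], ?_⟩
    rw [← this]; exact ho
  · right
    rw [hs] at h1
    have : (γ i).2 = b := by simp only at h1; omega
    refine ⟨this, h2.1, by rw [hs, this], ?_⟩
    rw [← this]; exact ho

/-- The edge of oriented percolation corresponding to an edge of the quadrant, when the
north-west oriented dual path starts at `(n + 1/2, 1/2)`. -/
def dualEdge (n : ℕ) (e : Edge) : Edge :=
  if e.2 then ((n - e.1.1, e.1.2), false) else ((n - e.1.1, e.1.2 - 1), true)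

lemma dualEdge_injective (n : ℕ) : Function.Injective (dualEdge n) := by
  rintro ⟨⟨x, y⟩, b⟩ ⟨⟨x', y'⟩, b'⟩ h
  cases b <;> cases b' <;> simp [dualEdge] at h ⊢ <;> omega

/-- The column `s` is blocked up to height `k`. -/
def blockedColumn (k s : ℕ) : Set Config :=
  {ω | ∀ e ∈ (Finset.range k).image fun t : ℕ => ((((s : ℤ), (t : ℤ)), false) : Edge),
    ω e = false}

lemma IsNEPath.mem_events (h : IsNEPath ω γ) {n k s : ℕ} (hs : s + k ≤ n)
    (hω : ω ∈ blockedColumn k s) :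
    (fun e => ω (dualEdge n e)) ∈ closedEvent n k ∪ openTopEvent n k := by
  set S : Set (ℕ × ℕ) := {v | ∃ i, v.1 + (γ i).1 ≤ n ∧ v.2 ≤ (γ i).2 ∧ (γ i).2 ≤ n} with hSdef
  have hnonneg : ∀ i, 0 ≤ (γ i).1 ∧ 0 ≤ (γ i).2 := fun i => by
    have := h.monotone (Nat.zero_le i)
    rw [h.zero] at this
    exact this
  have hS : IsShape n k S := by
    refine ⟨?_, ?_, ?_, ?_⟩
    · rintro ⟨x, y⟩ ⟨x', y'⟩ hle ⟨i, h1, h2, h3⟩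
      obtain ⟨hx, hy⟩ := Prod.mk_le_mk.1 hle
      refine ⟨i, ?_, ?_, h3⟩ <;> simp only at h1 h2 ⊢ <;> omega
    · rintro x y ⟨i, h1, h2, h3⟩
      have := hnonneg i
      simp only at h1; omega
    · rintro x y ⟨i, h1, h2, h3⟩
      simp only at h2; omega
    · rcases Nat.eq_zero_or_pos k with rfl | hk
      · exact ⟨0, by simp [h.zero]⟩
      · obtain ⟨i, ⟨h1, h2, h3, h4⟩ | ⟨h1, h2, h3, h4⟩⟩ :=
          h.exit (a := s) (b := k - 1) (by omega) (by omega)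
        · have := hω (((s : ℤ), (γ i).2), false) (Finset.mem_image.2 ⟨(γ i).2.toNat, ?_, ?_⟩)
          · rw [this] at h4; cases h4
          · have := hnonneg i
            rw [Finset.mem_range]; omega
          · rw [Int.toNat_of_nonneg (hnonneg i).2]
        · refine ⟨i + 1, ?_⟩
          rw [h3]; simp only; omega
  have hn0 : (n, 0) ∈ S := ⟨0, by simp [h.zero]⟩
  have hle : ∀ {i j}, (γ j).1 < (γ (i + 1)).1 → (γ j).2 ≤ (γ i).2 := by
    intro i j hij
    refine (h.monotone ?_).2
    by_contra! hlt
    have := (h.monotone (show i + 1 ≤ j from hlt)).1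
    omega
  have hh : HClosed (n + 1) (fun e => ω (dualEdge n e)) S := by
    rintro x y ⟨j, hj1, hj2, hj3⟩ - hy hn
    simp only at hj1 hj2
    have := hnonneg j
    obtain ⟨i, ⟨h1, h2, h3, h4⟩ | ⟨h1, h2, h3, h4⟩⟩ :=
      h.exit (a := n - x) (b := y - 1) (by omega) (by omega)
    · have := hle (i := i) (j := j) (by rw [h3]; simp only; omega)
      omega
    · have : (γ i).1 = n - x := by
        by_contra hne
        refine hn ⟨i + 1, ?_⟩
        rw [h3]; simp only; push_cast; omega
      rw [this] at h4
      simpa [dualEdge, hEdge] using h4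
  have hv : VClosed n (fun e => ω (dualEdge n e)) S := by
    rintro x y ⟨j, hj1, hj2, hj3⟩ hyn hx hn
    simp only at hj1 hj2
    have := hnonneg j
    obtain ⟨i, ⟨h1, h2, h3, h4⟩ | ⟨h1, h2, h3, h4⟩⟩ :=
      h.exit (a := n - x) (b := y) (by omega) (by omega)
    · have := hle (i := i) (j := j) (by rw [h3]; simp only; omega)
      have : (γ i).2 = y := by omega
      rw [this] at h4
      simpa [dualEdge, vEdge] using h4
    · refine (hn ⟨i + 1, ?_⟩).elim
      rw [h3]; simp only; push_cast; omega
  by_cases htop : (0, n) ∈ S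
  · exact .inr ⟨S, hS, ⟨hn0, htop⟩, hh, hv⟩
  · refine .inl ⟨S, hS, hn0, hh, fun x y h1 h2 h3 h4 => ?_⟩
    refine hv x y h1 (lt_of_le_of_ne (Nat.lt_succ_iff.1 h2) ?_) h3 h4
    rintro rfl
    exact htop (hS.lower (Prod.mk_le_mk.2 ⟨Nat.zero_le x, le_rfl⟩) h1)

end Paths

section Circuits

lemma IsLocal.preimage_reindex {ι : Type*} {F G : Finset ι} {A : Set (ι → Bool)} (hA : IsLocal F A)
    {φ : ι → ι} (hφ : ∀ e ∈ F, φ e ∈ G) : IsLocal G ((fun (ω : ι → Bool) e => ω (φ e)) ⁻¹' A) :=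
  fun _ _ h hω => hA _ _ (fun e he => h _ (hφ e he)) hω

lemma isUpperSet_preimage_reindex {ι : Type*} {A : Set (ι → Bool)} (hA : IsUpperSet A)
    (φ : ι → ι) : IsUpperSet ((fun (ω : ι → Bool) e => ω (φ e)) ⁻¹' A) :=
  fun _ _ hab ha => hA (fun e => hab (φ e)) ha

lemma isLocal_eq_true {ι : Type*} {F : Finset ι} {e : ι} (he : e ∈ F) :
    IsLocal F {η : ι → Bool | η e = true} :=
  fun _ _ h hω => (h e he).symm.trans hω

lemma isUpperSet_eq_true {ι : Type*} (e : ι) : IsUpperSet {η : ι → Bool | η e = true} :=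
  fun _ _ hle h => Bool.le_iff_imp.1 (hle e) h

/-- Closed square shapes around arbitrarily large squares have probability bounded below. -/
lemma exists_le_squareEvent {q q' : ℝ} (hq : 0 < q) (hq1 : q < 1) (hqq' : q ≤ q')
    (hθ : 0 < thetaVec q) (k : ℕ) :
    ∃ n, k ≤ n ∧ (thetaVec q / 2 / 2) ^ 2 ≤ bernPi Edge q' (squareEvent n k) := by
  classical
  set θ := thetaVec q with hθdef
  have hθeq : θ = bernPi Edge q {ω | percolates (neStep ω) Set.univ} := by
    rw [hθdef, thetaVec, mu, bernoulliProduct_eq_bernPi Edge hq hq1]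
  have hθtop : θ ≠ ∞ := by rw [hθeq]; exact measure_ne_top _ _
  obtain ⟨N, hN⟩ := bernPi_iInter_compl_lt (ι := Edge) q
    (F := fun s : ℕ => (Finset.range k).image fun t : ℕ => ((((s : ℤ), (t : ℤ)), false) : Edge))
    (A := blockedColumn k) (δ := ENNReal.ofReal (1 - q) ^ k) (ε := θ / 2)
    (by
      intro i j hij
      rw [Finset.disjoint_left]
      intro e h1 h2
      simp only [Finset.mem_image] at h1 h2
      obtain ⟨t, -, rfl⟩ := h1
      obtain ⟨t', -, h⟩ := h2
      simp at h
      omega)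
    (fun s ω ω' h hω e he => (h e he).symm.trans (hω e he))
    (by simpa [pos_iff_ne_zero] using fun h => absurd h (by simpa using hq1))
    (fun s => by
      rw [blockedColumn, bernPi_forall_false q hq.le]
      rw [Finset.card_image_of_injective _ (fun a b h => by simpa using h), Finset.card_range])
    (ENNReal.div_pos hθ.ne' (by simp))
  have hcover : {ω | percolates (neStep ω) Set.univ} ⊆
      ((fun ω e => ω (dualEdge (N + k) e)) ⁻¹' closedEvent (N + k) k ∪
        (fun ω e => ω (dualEdge (N + k) e)) ⁻¹' openTopEvent (N + k) k) ∪
      ⋂ s ∈ Finset.range N, (blockedColumn k s)ᶜ := by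
    rintro ω ⟨γ, h0, -, hstep, -⟩
    by_cases hb : ∃ s ∈ Finset.range N, ω ∈ blockedColumn k s
    · obtain ⟨s, hs, hb⟩ := hb
      refine .inl (IsNEPath.mem_events ⟨h0, hstep⟩ ?_ hb)
      have := Finset.mem_range.1 hs
      omega
    · push Not at hb
      exact .inr (Set.mem_iInter₂.2 hb)
  have hm : ∀ c b, MeasurableSet (shapeEvent (N + k) k c b) :=
    fun c b => (isLocal_shapeEvent _ _ c b).measurableSet
  have hsum : θ / 2 ≤ bernPi Edge q (closedEvent (N + k) k) +
      bernPi Edge q (openTopEvent (N + k) k) := by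
    have h1 : θ ≤ bernPi Edge q (closedEvent (N + k) k) +
        bernPi Edge q (openTopEvent (N + k) k) + θ / 2 := by
      rw [hθeq]
      refine (measure_mono hcover).trans ((measure_union_le _ _).trans ?_)
      rw [← hθeq]
      refine add_le_add ((measure_union_le _ _).trans ?_) hN.le
      exact (congrArg₂ (· + ·) (bernPi_preimage_reindex q (dualEdge_injective _) (hm _ _))
        (bernPi_preimage_reindex q (dualEdge_injective _) (hm _ _))).le
    have h2 : θ / 2 + θ / 2 ≤ bernPi Edge q (closedEvent (N + k) k) +
        bernPi Edge q (openTopEvent (N + k) k) + θ / 2 := by rwa [ENNReal.add_halves]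
    exact (ENNReal.add_le_add_iff_right (ENNReal.div_ne_top hθtop (by simp))).1 h2
  have hcase : ∀ c b, (∀ η : Config, η ∈ shapeEvent (N + k) k c b →
      (fun e => η (swapEdge e)) ∈ shapeEvent (N + k) k c b → η ∈ squareEvent (N + k) k) →
      θ / 2 / 2 ≤ bernPi Edge q (shapeEvent (N + k) k c b) →
      (θ / 2 / 2) ^ 2 ≤ bernPi Edge q' (squareEvent (N + k) k) := by
    intro c b hsq hle
    have hu := isUpperSet_shapeEvent (N + k) k c b
    have hl := isLocal_shapeEvent (N + k) k c b
    have hle' := hle.trans (bernPi_mono hqq' hu hl.measurableSet)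
    calc (θ / 2 / 2) ^ 2 = θ / 2 / 2 * (θ / 2 / 2) := sq _
      _ ≤ bernPi Edge q' (shapeEvent (N + k) k c b) *
          bernPi Edge q' ((fun ω e => ω (swapEdge e)) ⁻¹' shapeEvent (N + k) k c b) := by
        rw [bernPi_preimage_reindex q' swapEdge_involutive.injective hl.measurableSet]
        exact mul_le_mul' hle' hle'
      _ ≤ _ := bernPi_harris q' hl (hl.preimage_reindex fun e => swapEdge_mem_annulus) hu
        (isUpperSet_preimage_reindex hu _)
      _ ≤ _ := measure_mono fun η hη => hsq η hη.1 hη.2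
  refine ⟨N + k, by omega, ?_⟩
  by_cases h : θ / 2 / 2 ≤ bernPi Edge q (closedEvent (N + k) k)
  · exact hcase _ _ (fun η => squareEvent_of_closedEvent) h
  · refine hcase _ _ (fun η => squareEvent_of_openTopEvent) ?_
    by_contra h'
    push Not at h h'
    exact absurd hsum (not_le.2 (ENNReal.add_halves (θ / 2) ▸ ENNReal.add_lt_add h h'))

/-- The action on edges of the reflections in the axes selected by `s`. -/
def reflEdge (s : Bool × Bool) (e : Edge) : Edge :=
  ((if s.1 then -e.1.1 - (if e.2 then 0 else 1) else e.1.1,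
    if s.2 then -e.1.2 - (if e.2 then 1 else 0) else e.1.2), e.2)

lemma reflEdge_involutive (s : Bool × Bool) : Function.Involutive (reflEdge s) := by
  rintro ⟨⟨x, y⟩, b⟩
  obtain ⟨s₁, s₂⟩ := s
  cases s₁ <;> cases s₂ <;> cases b <;> simp [reflEdge]

lemma reflEdge_mem_annulus {n k : ℕ} (s : Bool × Bool) {e : Edge} (he : e ∈ annulus n k) :
    reflEdge s e ∈ annulus n k := by
  obtain ⟨⟨x, y⟩, b⟩ := e
  obtain ⟨s₁, s₂⟩ := s
  cases s₁ <;> cases s₂ <;> cases b <;>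
    simp only [mem_annulus, inBox, reflEdge, eSrc, eDst, abs_le] at he ⊢ <;>
    simp at he ⊢ <;> omega

/-- There is a closed square shape, and the edges leaving it along the axes are open. -/
def cornerEvent (n k : ℕ) : Set Config :=
  squareEvent n k ∩ ({η | η (hEdge n 0) = true} ∩ {η | η (vEdge 0 n) = true})

/-- All four reflections of the configuration have a closed corner. -/
def circuitEvent (n k : ℕ) : Set Config :=
  ⋂ s ∈ (Finset.univ : Finset (Bool × Bool)), (fun η e => η (reflEdge s e)) ⁻¹' cornerEvent n k

lemma isUpperSet_cornerEvent (n k : ℕ) : IsUpperSet (cornerEvent n k) :=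
  (isUpperSet_shapeEvent _ _ _ _).inter ((isUpperSet_eq_true _).inter (isUpperSet_eq_true _))

lemma isLocal_cornerEvent {n k : ℕ} (h : k ≤ n) : IsLocal (annulus n k) (cornerEvent n k) := by
  classical
  have hH : hEdge n 0 ∈ annulus n k := hEdge_mem_annulus le_rfl (Nat.zero_le n) (by omega)
  have hV : vEdge 0 n ∈ annulus n k := vEdge_mem_annulus (Nat.zero_le n) le_rfl (by omega)
  exact ((isLocal_shapeEvent _ _ _ _).inter ((isLocal_eq_true hH).inter (isLocal_eq_true hV))).mono
    (by simp)

/-- The intersection of local increasing events is at least as likely as if they were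
independent. -/
lemma pow_le_bernPi_biInter {ι κ : Type*} (q : ℝ) {F : Finset ι}
    {A : κ → Set (ι → Bool)} (hl : ∀ i, IsLocal F (A i)) (hu : ∀ i, IsUpperSet (A i)) {c : ℝ≥0∞}
    (hc : ∀ i, c ≤ bernPi ι q (A i)) (s : Finset κ) :
    IsLocal F (⋂ i ∈ s, A i) ∧ c ^ s.card ≤ bernPi ι q (⋂ i ∈ s, A i) := by
  classical
  induction s using Finset.induction_on with
  | empty => exact ⟨fun _ _ _ _ => by simp, by simp⟩
  | insert a s ha ih =>
    rw [Finset.set_biInter_insert]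
    refine ⟨((hl a).inter ih.1).mono (by simp), ?_⟩
    rw [Finset.card_insert_of_notMem ha, pow_succ']
    exact (mul_le_mul' (hc a) ih.2).trans
      (bernPi_harris q (hl a) ih.1 (hu a) (isUpperSet_iInter₂ fun i _ => hu i))

lemma le_cornerEvent {q : ℝ} (hq : q ≤ 1) {n k : ℕ} {c : ℝ≥0∞}
    (hc : c ≤ bernPi Edge q (squareEvent n k)) :
    c * (ENNReal.ofReal q * ENNReal.ofReal q) ≤ bernPi Edge q (cornerEvent n k) := by
  classical
  have hH := isLocal_eq_true (Finset.mem_singleton_self (hEdge n 0))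
  have hV := isLocal_eq_true (Finset.mem_singleton_self (vEdge 0 n))
  refine le_trans (mul_le_mul' hc ?_) (bernPi_harris q (isLocal_shapeEvent _ _ _ _) (hH.inter hV)
    (isUpperSet_shapeEvent _ _ _ _) ((isUpperSet_eq_true _).inter (isUpperSet_eq_true _)))
  refine le_trans (le_of_eq ?_)
    (bernPi_harris q hH hV (isUpperSet_eq_true _) (isUpperSet_eq_true _))
  rw [bernPi_true q hq, bernPi_true q hq]

lemma circuitEvent_bound {q : ℝ} (hq : q ≤ 1) {n k : ℕ} (h : k ≤ n) {c : ℝ≥0∞}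
    (hc : c ≤ bernPi Edge q (squareEvent n k)) :
    IsLocal (annulus n k) (circuitEvent n k) ∧
      (c * (ENNReal.ofReal q * ENNReal.ofReal q)) ^ 4 ≤ bernPi Edge q (circuitEvent n k) := by
  have := pow_le_bernPi_biInter q (F := annulus n k)
    (A := fun s : Bool × Bool => (fun η e => η (reflEdge s e)) ⁻¹' cornerEvent n k)
    (fun s => (isLocal_cornerEvent h).preimage_reindex fun e => reflEdge_mem_annulus s)
    (fun s => isUpperSet_preimage_reindex (isUpperSet_cornerEvent n k) _)
    (c := c * (ENNReal.ofReal q * ENNReal.ofReal q)) (fun s => by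
      rw [bernPi_preimage_reindex q (reflEdge_involutive s).injective
        (isLocal_cornerEvent h).measurableSet]
      exact le_cornerEvent hq hc) Finset.univ
  simpa [circuitEvent] using this

/-- The image of the point `(x, y)` under the reflections in the axes selected by `s`. -/
def reflPt (s : Bool × Bool) (x y : ℕ) : ℤ × ℤ :=
  (if s.1 then -(x : ℤ) else x, if s.2 then -(y : ℤ) else y)

lemma exists_reflEdge (e : Edge) :
    ∃ s x y, e = reflEdge s (hEdge x y) ∨ e = reflEdge s (vEdge x y) := by
  obtain ⟨⟨a, b⟩, _ | _⟩ := e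
  · obtain ⟨y, rfl | rfl⟩ := b.eq_nat_or_neg <;> rcases a with x | x
    · exact ⟨(false, false), x, y, .inl (by simp [reflEdge, hEdge])⟩
    · exact ⟨(true, false), x, y, .inl (by simp [reflEdge, hEdge]; omega)⟩
    · exact ⟨(false, true), x, y, .inl (by simp [reflEdge, hEdge])⟩
    · exact ⟨(true, true), x, y, .inl (by simp [reflEdge, hEdge]; omega)⟩
  · obtain ⟨x, rfl | rfl⟩ := a.eq_nat_or_neg <;> rcases b with y | y
    · exact ⟨(false, false), x, y, .inr (by simp [reflEdge, vEdge])⟩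
    · exact ⟨(false, true), x, y, .inr (by simp [reflEdge, vEdge]; omega)⟩
    · exact ⟨(true, false), x, y, .inr (by simp [reflEdge, vEdge])⟩
    · exact ⟨(true, true), x, y, .inr (by simp [reflEdge, vEdge]; omega)⟩

lemma endpoints_reflEdge_hEdge (s : Bool × Bool) (x y : ℕ) :
    (eSrc (reflEdge s (hEdge x y)) = reflPt s x y ∧
      eDst (reflEdge s (hEdge x y)) = reflPt s (x + 1) y) ∨
    (eSrc (reflEdge s (hEdge x y)) = reflPt s (x + 1) y ∧
      eDst (reflEdge s (hEdge x y)) = reflPt s x y) := by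
  obtain ⟨_ | _, s₂⟩ := s
  · left; simp [eSrc, eDst, reflEdge, hEdge, reflPt]
  · right; simp [eSrc, eDst, reflEdge, hEdge, reflPt]; omega

lemma endpoints_reflEdge_vEdge (s : Bool × Bool) (x y : ℕ) :
    (eSrc (reflEdge s (vEdge x y)) = reflPt s x y ∧
      eDst (reflEdge s (vEdge x y)) = reflPt s x (y + 1)) ∨
    (eSrc (reflEdge s (vEdge x y)) = reflPt s x (y + 1) ∧
      eDst (reflEdge s (vEdge x y)) = reflPt s x y) := by
  obtain ⟨s₁, _ | _⟩ := s
  · left; simp [eSrc, eDst, reflEdge, vEdge, reflPt]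
  · right; simp [eSrc, eDst, reflEdge, vEdge, reflPt]; omega

lemma normSq_reflPt (s : Bool × Bool) (x y : ℕ) : normSq (reflPt s x y) = x ^ 2 + y ^ 2 := by
  obtain ⟨s₁, s₂⟩ := s
  cases s₁ <;> cases s₂ <;> simp [normSq, reflPt]

/-- A finite set containing the origin which no step can leave precludes percolation. -/
lemma not_percolates_of_finite {R : ℤ × ℤ → ℤ × ℤ → Prop} {S : Set (ℤ × ℤ)} (hS : S.Finite)
    (h0 : (0, 0) ∈ S) (hR : ∀ u v, R u v → u ∈ S → v ∈ S) : ¬ percolates R Set.univ := by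
  rintro ⟨γ, hγ0, hinj, hstep, -⟩
  have hmem : ∀ n, γ n ∈ S := fun n => by
    induction n with
    | zero => rwa [hγ0]
    | succ n ih => exact hR _ _ (hstep n) ih
  exact Set.infinite_of_injective_forall_mem hinj hmem hS

lemma not_percolates_of_mem_circuitEvent {n k : ℕ} {ω : Config}
    (h : (fun e => !ω e) ∈ circuitEvent n k) : ¬ percolates (hStep ω) Set.univ := by
  simp only [circuitEvent, Finset.mem_univ, Set.iInter_true, Set.mem_iInter, Set.mem_preimage] at h
  choose h hax using h
  choose T hT hc hh hv using h
  have hx : ∀ s x, (x, 0) ∈ T s ↔ x ≤ n := fun s x =>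
    ⟨(hT s).le_left x 0, fun hx => (hT s).lower (Prod.mk_le_mk.2 ⟨hx, le_rfl⟩) (hc s).1⟩
  have hy : ∀ s y, (0, y) ∈ T s ↔ y ≤ n := fun s y =>
    ⟨(hT s).le_right 0 y, fun hy => (hT s).lower (Prod.mk_le_mk.2 ⟨le_rfl, hy⟩) (hc s).2⟩
  set S : Set (ℤ × ℤ) := {v | (v.1.natAbs, v.2.natAbs) ∈ T (decide (v.1 < 0), decide (v.2 < 0))}
    with hS
  have hmem : ∀ s x y, reflPt s x y ∈ S ↔ (x, y) ∈ T s := by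
    rintro ⟨s₁, s₂⟩ x y
    have habs : (reflPt (s₁, s₂) x y).1.natAbs = x ∧ (reflPt (s₁, s₂) x y).2.natAbs = y := by
      cases s₁ <;> cases s₂ <;> simp [reflPt]
    rw [hS, Set.mem_ofPred_eq, habs.1, habs.2]
    rcases Nat.eq_zero_or_pos x with rfl | hx0
    · rw [hy, hy]
    rcases Nat.eq_zero_or_pos y with rfl | hy0
    · rw [hx, hx]
    have : (decide ((reflPt (s₁, s₂) x y).1 < 0), decide ((reflPt (s₁, s₂) x y).2 < 0)) =
        (s₁, s₂) := by
      cases s₁ <;> cases s₂ <;> simp [reflPt] <;> omega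
    rw [this]
  have hleave : ∀ {e u v P Q}, ((eSrc e = P ∧ eDst e = Q) ∨ (eSrc e = Q ∧ eDst e = P)) →
      ((eSrc e = u ∧ eDst e = v) ∨ (eSrc e = v ∧ eDst e = u)) →
      ω e = decide (normSq u < normSq v) → (Q ∈ S → P ∈ S) → normSq P < normSq Q →
      (P ∈ S → Q ∉ S → ω e = false) → u ∈ S → v ∈ S := by
    intro e u v P Q hPQ huv hω hlow hlt hcl hu
    by_contra hv
    have : (u = P ∧ v = Q) ∨ (u = Q ∧ v = P) := by
      rcases hPQ with ⟨h1, h2⟩ | ⟨h1, h2⟩ <;> rcases huv with ⟨h3, h4⟩ | ⟨h3, h4⟩ <;>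
        rw [← h1, ← h2, ← h3, ← h4] <;> simp
    rcases this with ⟨rfl, rfl⟩ | ⟨rfl, rfl⟩
    · rw [hcl hu hv] at hω
      simp [hlt] at hω
    · exact hv (hlow hu)
  refine not_percolates_of_finite (S := S) ?_ ?_ ?_
  · refine (Set.finite_Icc ((-n, -n) : ℤ × ℤ) (n, n)).subset fun v hv => ?_
    have h1 := (hT _).le_left _ _ hv
    have h2 := (hT _).le_right _ _ hv
    simp only [Set.mem_Icc, Prod.le_def]
    omega
  · have := (hmem (false, false) 0 0).2 ((hx _ _).2 (Nat.zero_le n))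
    simpa [reflPt] using this
  · rintro u v ⟨e, huv, hω⟩ hu
    obtain ⟨s, x, y, rfl | rfl⟩ := exists_reflEdge e
    · refine hleave (endpoints_reflEdge_hEdge s x y) huv hω ?_ ?_ ?_ hu
      · rw [hmem, hmem]
        exact (hT s).lower (Prod.mk_le_mk.2 ⟨Nat.le_succ x, le_rfl⟩)
      · rw [normSq_reflPt, normSq_reflPt]; push_cast; nlinarith [Int.natCast_nonneg x, Int.natCast_nonneg y]
      · rw [hmem, hmem]
        intro h1 h2
        rcases Nat.eq_zero_or_pos y with rfl | hy0
        · rw [hx] at h1 h2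
          obtain rfl : x = n := by omega
          simpa using (hax s).1
        · have := hh s x y h1 (Nat.lt_succ_of_le ((hT s).le_left _ _ h1)) hy0 h2
          simpa using this
    · refine hleave (endpoints_reflEdge_vEdge s x y) huv hω ?_ ?_ ?_ hu
      · rw [hmem, hmem]
        exact (hT s).lower (Prod.mk_le_mk.2 ⟨le_rfl, Nat.le_succ y⟩)
      · rw [normSq_reflPt, normSq_reflPt]; push_cast; nlinarith [Int.natCast_nonneg x, Int.natCast_nonneg y]
      · rw [hmem, hmem]
        intro h1 h2
        rcases Nat.eq_zero_or_pos x with rfl | hx0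
        · rw [hy] at h1 h2
          obtain rfl : y = n := by omega
          simpa using (hax s).2
        · have := hv s x y h1 (Nat.lt_succ_of_le ((hT s).le_right _ _ h1)) hx0 h2
          simpa using this

end Circuits

/-- For every `p` with `0 < p < 1 - p⃗_c`, the H-model with parameter `p` does not
percolate. -/
theorem thetaH_eq_zero_of_lt_one_sub_vecPc (p : ℝ) (hp : 0 < p) (hp' : p < 1 - vecPc) :
    thetaH p = 0 := by
  obtain ⟨q, hθ, hq⟩ : ∃ q ∈ {p : ℝ | 0 < thetaVec p}, q < 1 - p :=
    exists_lt_of_csInf_lt ⟨1, thetaVec_one_pos⟩ (by rw [← vecPc]; linarith)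
  have hq0 : 0 < q := by
    by_contra! h
    exact hθ.ne' (thetaVec_of_nonpos h)
  have hp1 : p < 1 := by linarith
  set δ : ℝ≥0∞ := ((thetaVec q / 2 / 2) ^ 2 *
    (ENNReal.ofReal (1 - p) * ENNReal.ofReal (1 - p))) ^ 4 with hδdef
  have hδ : 0 < δ := by
    have h1 : 0 < ENNReal.ofReal (1 - p) := ENNReal.ofReal_pos.2 (by linarith)
    have h2 : 0 < thetaVec q / 2 / 2 := ENNReal.div_pos (ENNReal.div_pos (ne_of_gt hθ) (by simp)).ne' (by simp)
    exact ENNReal.pow_pos (ENNReal.mul_pos (ENNReal.pow_pos h2 2).ne'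
      (ENNReal.mul_pos h1.ne' h1.ne').ne') 4
  choose N hN hsq using exists_le_squareEvent hq0 (by linarith) hq.le hθ
  have hcirc := fun k => circuitEvent_bound (q := 1 - p) (by linarith) (hN k) (hsq k)
  let k : ℕ → ℕ := fun j => (fun m => N m + 1)^[j] 0
  have hk : ∀ j, k (j + 1) = N (k j) + 1 := fun j => Function.iterate_succ_apply' _ _ _
  have hmono : Monotone k := monotone_nat_of_le_succ fun j => by
    have := hN (k j)
    rw [hk]; omega
  have hdisj : ∀ i j, i < j → Disjoint (annulus (N (k i)) (k i)) (annulus (N (k j)) (k j)) :=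
    fun i j hij => annulus_disjoint ((hk i).symm.le.trans (hmono hij))
  refine le_antisymm (le_of_forall_gt fun ε hε => ?_) zero_le
  obtain ⟨M, hM⟩ := bernPi_iInter_compl_lt (1 - p) hdisj (fun j => (hcirc (k j)).1) hδ
    (fun j => (hcirc (k j)).2) hε
  refine lt_of_le_of_lt ?_ hM
  have hmeas : MeasurableSet (⋂ j ∈ Finset.range M, (circuitEvent (N (k j)) (k j))ᶜ) :=
    Finset.measurableSet_biInter _ fun j _ => (hcirc (k j)).1.measurableSet.compl
  rw [thetaH, mu, bernoulliProduct_eq_bernPi Edge hp hp1, ← bernPi_map_not hp.le hp1.le,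
    Measure.map_apply (by fun_prop) hmeas]
  refine measure_mono fun ω hω => Set.mem_iInter₂.2 fun j _ hmem => ?_
  exact not_percolates_of_mem_circuitEvent hmem hω

end RandomOrientation
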